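/- Let n ≥ 1, fix x₀ ∈ ℝⁿ, R > 0, t₀ ∈ ℝ, T > 0 and D > 0. Let u be a smooth function on Q_{R,T} = B(x₀,R) × [t₀−T,t₀] ⊆ ℝⁿ × ℝ with 0 < u ≤ D solving the heat equation ∂u/∂t = Δu, where Δ is the Euclidean Laplacian. Then there exists a constant c depending only on n such that for all (x,t) ∈ B(x₀,R/2) × (t₀−T, t₀], |∇u|(x,t)/√(u(x,t)) ≤ c·√D·( 1/R + 1/√(t−t₀+T) ). (This is the Euclidean-space case of the paper's estimate (3.12), the elliptic gradient estimate for the heat equation with f constant, where K = 0 since the Euclidean Ricci curvature vanishes.) -/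

import Mathlib

open Metric Set
open scoped RealInnerProductSpace

noncomputable section

/-- Euclidean Laplacian on `EuclideanSpace ℝ (Fin n)`. -/
def eLap {n : ℕ} (u : EuclideanSpace ℝ (Fin n) → ℝ) (x : EuclideanSpace ℝ (Fin n)) : ℝ :=
  ∑ i : Fin n,
    fderiv ℝ (fun y => fderiv ℝ u y (EuclideanSpace.single i 1)) x (EuclideanSpace.single i 1)

/-- Weighted (drift) Laplacian `Δ_f u = Δu − ⟨∇f, ∇u⟩`. -/
def fLap {n : ℕ} (f u : EuclideanSpace ℝ (Fin n) → ℝ) (x : EuclideanSpace ℝ (Fin n)) : ℝ :=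
  eLap u x - ⟪gradient f x, gradient u x⟫

/-- Hessian quadratic form of `f` at `x` evaluated at `(v, v)`. -/
def hessQF {n : ℕ} (f : EuclideanSpace ℝ (Fin n) → ℝ) (x v : EuclideanSpace ℝ (Fin n)) : ℝ :=
  fderiv ℝ (fun y => fderiv ℝ f y v) x v

/-- The constant `α = max_{|x−x₀|=1} ((n−1) − ⟨∇f(x), x−x₀⟩)`. -/
def alphaC {n : ℕ} (f : EuclideanSpace ℝ (Fin n) → ℝ) (x₀ : EuclideanSpace ℝ (Fin n)) : ℝ :=
  sSup ((fun y => (n : ℝ) - 1 - ⟪gradient f y, y - x₀⟫) '' sphere x₀ 1)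

section helpers
open Filter Topology

lemma second_test (f f1 : ℝ → ℝ) (f2 : ℝ) (h : ∀ᶠ s in 𝓝 (0:ℝ), HasDerivAt f (f1 s) s)
    (h1 : HasDerivAt f1 f2 0) (hm : IsLocalMax f 0) : f1 0 = 0 ∧ f2 ≤ 0 := by
  have h0 : f1 0 = 0 := hm.hasDerivAt_eq_zero h.self_of_nhds
  refine ⟨h0, ?_⟩
  by_contra! hpos
  have e1 : deriv f =ᶠ[𝓝 0] f1 := h.mono fun s hs => hs.deriv
  have e2 : deriv (deriv f) 0 = f2 := by rw [e1.deriv_eq, h1.deriv]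
  have hmin := isLocalMin_of_deriv_deriv_pos (f := f) (x₀ := 0) (by rw [e2]; exact hpos)
    (by rw [e1.self_of_nhds, h0]) h.self_of_nhds.continuousAt
  have hc : f =ᶠ[𝓝 0] fun _ => f 0 := by
    filter_upwards [hm, hmin] with s a b using le_antisymm a b
  have e3 : deriv f =ᶠ[𝓝 0] fun _ => 0 := by
    have := hc.deriv
    simpa using this
  have : deriv (deriv f) 0 = 0 := by rw [e3.deriv_eq]; simp
  linarith

lemma left_test (f : ℝ → ℝ) (f1 : ℝ) (h : HasDerivAt f f1 0)
    (hm : ∀ᶠ s in 𝓝[<] (0:ℝ), f s ≤ f 0) : 0 ≤ f1 := by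
  have := (hasDerivAt_iff_tendsto_slope_left_right.1 h).1
  refine ge_of_tendsto this ?_
  filter_upwards [hm, self_mem_nhdsWithin] with s hs hs0
  rw [slope_def_field]
  exact div_nonneg_of_nonpos (by linarith) (by simpa using le_of_lt hs0)

lemma line_test {n : ℕ} (H H1 : ℝ → ℝ) (H2 : ℝ) (V V1 : Fin n → ℝ → ℝ) (V2 : Fin n → ℝ)
    (W W1 : ℝ → ℝ) (W2 M : ℝ)
    (hH : ∀ s, HasDerivAt H (H1 s) s) (hH1 : HasDerivAt H1 H2 0)
    (hV : ∀ j, ∀ᶠ s in 𝓝 (0:ℝ), HasDerivAt (V j) (V1 j s) s)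
    (hV1 : ∀ j, HasDerivAt (V1 j) (V2 j) 0)
    (hW : ∀ᶠ s in 𝓝 (0:ℝ), HasDerivAt W (W1 s) s) (hW1 : HasDerivAt W1 W2 0)
    (hm : IsLocalMax (fun s => H s * ∑ j, V j s ^ 2 - M * W s) 0) :
    H1 0 * (∑ j, V j 0 ^ 2) + 2 * H 0 * (∑ j, V1 j 0 * V j 0) = M * W1 0 ∧
    H2 * (∑ j, V j 0 ^ 2) + 4 * H1 0 * (∑ j, V1 j 0 * V j 0)
      + 2 * H 0 * (∑ j, (V2 j * V j 0 + V1 j 0 ^ 2)) - M * W2 ≤ 0 := by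
  have key := second_test _ (fun s => H1 s * (∑ j, V j s ^ 2)
      + H s * (∑ j, 2 * (V1 j s * V j s)) - M * W1 s)
    (H2 * (∑ j, V j 0 ^ 2) + H1 0 * (∑ j, 2 * (V1 j 0 * V j 0)) + (H1 0 * (∑ j, 2 * (V1 j 0 * V j 0))
      + H 0 * (∑ j, 2 * (V2 j * V j 0 + V1 j 0 * V1 j 0))) - M * W2) ?_ ?_ hm
  · obtain ⟨k1, k2⟩ := key
    simp only [← Finset.mul_sum, ← pow_two] at k1 k2
    constructor <;> linarith
  · filter_upwards [eventually_all.2 hV, hW] with s hv hw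
    refine (((hH s).mul (HasDerivAt.fun_sum fun j _ => ?_)).sub (hw.const_mul M))
    exact ((hv j).fun_pow 2).congr_deriv (by norm_num; ring)
  · have v0 : ∀ j, HasDerivAt (V j) (V1 j 0) 0 := fun j => (hV j).self_of_nhds
    refine ((hH1.mul (HasDerivAt.fun_sum fun j _ => ?_)).add ((hH 0).mul (HasDerivAt.fun_sum fun j _ => ?_))).sub (hW1.const_mul M)
    · exact ((v0 j).fun_pow 2).congr_deriv (by norm_num; ring)
    · exact ((hV1 j).mul (v0 j)).const_mul 2

lemma alg_core {n : ℕ} (h k : Fin n → Fin n → ℝ) (d v vt : Fin n → ℝ) (M u ut ρ σ r : ℝ)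
    (hM : 0 < M) (hu : 0 < u) (hσ : 0 < σ) (hr : r = ∑ i, d i ^ 2) (hρ : r < ρ ^ 2)
    (hMu : σ * (ρ ^ 2 - r) ^ 2 * ∑ j, v j ^ 2 = M * u)
    (h1 : ∀ i, (-4 * σ * (ρ ^ 2 - r) * d i) * (∑ j, v j ^ 2)
      + 2 * (σ * (ρ ^ 2 - r) ^ 2) * (∑ j, h i j * v j) = M * v i)
    (h2 : ∀ i, (σ * (-4 * (ρ ^ 2 - r) + 8 * d i ^ 2)) * (∑ j, v j ^ 2)
      + 4 * (-4 * σ * (ρ ^ 2 - r) * d i) * (∑ j, h i j * v j)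
      + 2 * (σ * (ρ ^ 2 - r) ^ 2) * (∑ j, (k i j * v j + h i j ^ 2)) - M * h i i ≤ 0)
    (h3 : 0 ≤ (ρ ^ 2 - r) ^ 2 * (∑ j, v j ^ 2)
      + 2 * (σ * (ρ ^ 2 - r) ^ 2) * (∑ j, vt j * v j) - M * ut)
    (hut : ut = ∑ i, h i i) (hvt : ∀ j, vt j = ∑ i, k i j) :
    M ≤ u * (4 * ρ ^ 4 + (16 * n + 160) * ρ ^ 2 * σ) := by
  set g := ∑ j, v j ^ 2 with hg
  set e := ρ ^ 2 - r with he
  have hepos : 0 < e := by linarith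
  have hr0 : 0 ≤ r := by rw [hr]; positivity
  have hgpos : 0 < g := by
    by_contra! hc
    have : σ * e ^ 2 * g ≤ 0 := mul_nonpos_of_nonneg_of_nonpos (by positivity) hc
    have := mul_pos hM hu
    linarith
  set w : Fin n → ℝ := fun i => ∑ j, h i j * v j with hw
  set q := ∑ i, d i * v i with hq
  have hqq : q ^ 2 ≤ r * g := by
    rw [hr, hg]; exact Finset.sum_mul_sq_le_sq_mul_sq _ _ _
  -- sum of h2
  have s2 := Finset.sum_le_sum fun i (_ : i ∈ Finset.univ) => h2 i
  set S := ∑ i, ∑ j, h i j ^ 2 with hS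
  have hdw : ∑ i, d i * w i = (M * q + 4 * σ * e * g * r) / (2 * (σ * e ^ 2)) := by
    rw [eq_div_iff (by positivity), hr, hq, Finset.sum_mul, Finset.mul_sum, Finset.mul_sum,
      ← Finset.sum_add_distrib]
    refine Finset.sum_congr rfl fun i _ => ?_
    linear_combination d i * h1 i
  have hww : 4 * (σ * e ^ 2) ^ 2 * ∑ i, w i ^ 2
      = M ^ 2 * g + 8 * σ * e * g * M * q + 16 * σ ^ 2 * e ^ 2 * g ^ 2 * r := by
    have e1 : ∀ i, 4 * (σ * e ^ 2) ^ 2 * w i ^ 2 = M ^ 2 * v i ^ 2 + 8 * σ * e * g * M * (d i * v i)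
        + 16 * σ ^ 2 * e ^ 2 * g ^ 2 * d i ^ 2 := by
      intro i
      have e2 : 2 * (σ * e ^ 2) * w i = M * v i + 4 * σ * e * d i * g := by linarith [h1 i]
      calc 4 * (σ * e ^ 2) ^ 2 * w i ^ 2 = (2 * (σ * e ^ 2) * w i) ^ 2 := by ring
        _ = _ := by rw [e2]; ring
    rw [Finset.mul_sum, Finset.sum_congr rfl fun i _ => e1 i, Finset.sum_add_distrib,
      Finset.sum_add_distrib, ← Finset.mul_sum, ← Finset.mul_sum, ← Finset.mul_sum, ← hg, ← hq, ← hr]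
  have hwS : ∑ i, w i ^ 2 ≤ S * g := by
    rw [hS, Finset.sum_mul]
    exact Finset.sum_le_sum fun i _ => Finset.sum_mul_sq_le_sq_mul_sq _ _ _
  have hvv : ∑ j, vt j * v j = ∑ i, ∑ j, k i j * v j := by
    rw [Finset.sum_comm]
    exact Finset.sum_congr rfl fun j _ => by rw [hvt, Finset.sum_mul]
  have s2' : σ * (-4 * e * n + 8 * r) * g - 16 * σ * e * (∑ i, d i * w i)
      + 2 * (σ * e ^ 2) * (∑ j, vt j * v j + S) - M * ut ≤ 0 := by
    have e1 : ∀ i, σ * (-4 * e + 8 * d i ^ 2) * g + 4 * (-4 * σ * e * d i) * (∑ j, h i j * v j)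
          + 2 * (σ * e ^ 2) * (∑ j, (k i j * v j + h i j ^ 2)) - M * h i i
        = σ * (-4) * e * g + 8 * σ * g * d i ^ 2 + (-16) * σ * e * (d i * w i)
          + 2 * (σ * e ^ 2) * (∑ j, k i j * v j) + 2 * (σ * e ^ 2) * (∑ j, h i j ^ 2)
          + (-M) * h i i := by
      intro i
      rw [Finset.sum_add_distrib]
      simp only [hw]
      ring
    rw [Finset.sum_congr rfl fun i _ => e1 i] at s2
    simp only [Finset.sum_add_distrib, ← Finset.mul_sum, ← hr, ← hS, ← hut, ← hvv,
      Finset.sum_const, Finset.card_univ, Fintype.card_fin, nsmul_eq_mul, mul_zero] at s2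
    linarith
  have main : 2 * (σ * e ^ 2) * S ≤ (e ^ 2 + σ * (4 * e * n - 8 * r)) * g
      + 16 * σ * e * (∑ i, d i * w i) := by linarith
  have m1 : M ^ 2 + 8 * σ * e * M * q + 16 * σ ^ 2 * e ^ 2 * g * r ≤ 4 * (σ * e ^ 2) ^ 2 * S := by
    refine le_of_mul_le_mul_right ?_ hgpos
    have := mul_le_mul_of_nonneg_left hwS (by positivity : 0 ≤ 4 * (σ * e ^ 2) ^ 2)
    rw [hww] at this
    linarith
  have m2 : 4 * (σ * e ^ 2) ^ 2 * S ≤ 2 * (σ * e ^ 2 * g) * (e ^ 2 + σ * (4 * e * n - 8 * r))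
      + 16 * σ * e * (M * q + 4 * σ * e * g * r) := by
    have := mul_le_mul_of_nonneg_left main (by positivity : 0 ≤ 2 * (σ * e ^ 2))
    have e3 : (∑ i, d i * w i) * (2 * (σ * e ^ 2)) = M * q + 4 * σ * e * g * r := by
      rw [hdw]; field_simp
    rw [← e3]
    linarith
  have m3 : 8 * σ * e * M * q ≤ M ^ 2 / 2 + 32 * σ * r * (σ * e ^ 2 * g) := by
    have a1 := sq_nonneg (M - 8 * σ * e * q)
    have a2 := mul_le_mul_of_nonneg_left hqq (by positivity : 0 ≤ 32 * σ ^ 2 * e ^ 2)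
    linarith
  have m4 : M ^ 2 / 2 ≤ (σ * e ^ 2 * g) * (2 * (e ^ 2 + σ * (4 * e * n - 8 * r)) + 80 * σ * r) := by
    linarith
  rw [hMu] at m4
  have m5 : M ≤ u * (4 * (e ^ 2 + σ * (4 * e * n - 8 * r)) + 160 * σ * r) := by
    refine le_of_mul_le_mul_left ?_ hM
    linarith
  refine m5.trans (mul_le_mul_of_nonneg_left ?_ hu.le)
  have b1 : e ^ 2 ≤ ρ ^ 4 := by
    have : e ≤ ρ ^ 2 := by linarith
    calc e ^ 2 ≤ (ρ ^ 2) ^ 2 := by gcongr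
      _ = ρ ^ 4 := by ring
  have b2 : σ * (e * n) ≤ σ * (ρ ^ 2 * n) := by
    gcongr; linarith
  have b3 : σ * r ≤ σ * ρ ^ 2 := by gcongr
  have b4 : 0 ≤ σ * r := by positivity
  linarith

section pdsec
variable {F : Type*} [NormedAddCommGroup F] [NormedSpace ℝ F]

/-- directional derivative -/
def pd (e : F) (f : F → ℝ) : F → ℝ := fun p => fderiv ℝ f p e

lemma pd_smooth {Ω : Set F} (hΩ : IsOpen Ω) {f : F → ℝ} (hf : ContDiffOn ℝ (⊤ : ℕ∞) f Ω) (e : F) :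
    ContDiffOn ℝ (⊤ : ℕ∞) (pd e f) Ω :=
  (hf.fderiv_of_isOpen hΩ (by simp)).clm_apply contDiffOn_const

lemma pd_diff {Ω : Set F} (hΩ : IsOpen Ω) {f : F → ℝ} (hf : ContDiffOn ℝ (⊤ : ℕ∞) f Ω) {p : F}
    (hp : p ∈ Ω) : DifferentiableAt ℝ f p :=
  (hf.contDiffAt (hΩ.mem_nhds hp)).differentiableAt (by simp)

lemma pd_line {Ω : Set F} (hΩ : IsOpen Ω) {f : F → ℝ} (hf : ContDiffOn ℝ (⊤ : ℕ∞) f Ω) (e p : F)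
    (s : ℝ) (hp : p + s • e ∈ Ω) :
    HasDerivAt (fun s : ℝ => f (p + s • e)) (pd e f (p + s • e)) s := by
  have h1 : HasDerivAt (fun s : ℝ => p + s • e) e s := by
    simpa using ((hasDerivAt_id s).smul_const e).const_add p
  exact (pd_diff hΩ hf hp).hasFDerivAt.comp_hasDerivAt s h1

lemma pd_comm {Ω : Set F} (hΩ : IsOpen Ω) {f : F → ℝ} (hf : ContDiffOn ℝ (⊤ : ℕ∞) f Ω) (e e' : F)
    {p : F} (hp : p ∈ Ω) : pd e (pd e' f) p = pd e' (pd e f) p := by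
  have hs : IsSymmSndFDerivAt ℝ f p := (hf.contDiffAt (hΩ.mem_nhds hp)).isSymmSndFDerivAt (by
    rw [minSmoothness_of_isRCLikeNormedField]; exact WithTop.coe_le_coe.2 le_top)
  have hd : DifferentiableAt ℝ (fderiv ℝ f) p :=
    ((hf.fderiv_of_isOpen hΩ (m := (⊤ : ℕ∞)) (by simp)).contDiffAt (hΩ.mem_nhds hp)).differentiableAt (by simp)
  have key : ∀ a b : F, pd a (pd b f) p = fderiv ℝ (fderiv ℝ f) p a b := by
    intro a b
    unfold pd
    rw [fderiv_clm_apply hd (differentiableAt_const b)]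
    simp
  rw [key, key]
  exact hs e e'

lemma pd_congr {Ω : Set F} (hΩ : IsOpen Ω) {f g : F → ℝ} (h : ∀ p ∈ Ω, f p = g p) (e : F)
    {p : F} (hp : p ∈ Ω) : pd e f p = pd e g p := by
  unfold pd
  have : f =ᶠ[𝓝 p] g := by
    filter_upwards [hΩ.mem_nhds hp] with q hq using h q hq
  rw [this.fderiv_eq]

lemma pd_sum {n : ℕ} (f : Fin n → F → ℝ) (e p : F) (h : ∀ i, DifferentiableAt ℝ (f i) p) :
    pd e (fun q => ∑ i, f i q) p = ∑ i, pd e (f i) p := by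
  unfold pd
  rw [fderiv_fun_sum fun i _ => h i]
  simp

end pdsec

/-- spatial unit vectors in space-time -/
def eS {n : ℕ} (i : Fin n) : EuclideanSpace ℝ (Fin n) × ℝ := (EuclideanSpace.single i 1, 0)

lemma interior_est {n : ℕ} (x₀ : EuclideanSpace ℝ (Fin n)) (ρ a b D : ℝ) (hρ : 0 < ρ) (hD : 0 < D)
    (hab : a < b) (Ω : Set (EuclideanSpace ℝ (Fin n) × ℝ)) (hΩ : IsOpen Ω)
    (hK : closedBall x₀ ρ ×ˢ Icc a b ⊆ Ω) (U : EuclideanSpace ℝ (Fin n) × ℝ → ℝ)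
    (hU : ContDiffOn ℝ (⊤ : ℕ∞) U Ω) (hpos : ∀ p ∈ Ω, 0 < U p ∧ U p ≤ D)
    (heat : ∀ p ∈ Ω, pd (0, 1) U p = ∑ i, pd (eS i) (pd (eS i) U) p)
    (x : EuclideanSpace ℝ (Fin n)) (hx : x ∈ closedBall x₀ ρ) :
    (b - a) * (ρ ^ 2 - ‖x - x₀‖ ^ 2) ^ 2 * (∑ i, pd (eS i) U (x, b) ^ 2) ≤
      U (x, b) * (D * (4 * ρ ^ 4 + (16 * n + 160) * ρ ^ 2 * (b - a))) := by
  set g : EuclideanSpace ℝ (Fin n) × ℝ → ℝ := fun p => ∑ i, pd (eS i) U p ^ 2 with hg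
  set η : EuclideanSpace ℝ (Fin n) × ℝ → ℝ := fun p => (p.2 - a) * (ρ ^ 2 - ‖p.1 - x₀‖ ^ 2) ^ 2 with hη
  set K := closedBall x₀ ρ ×ˢ Icc a b with hKdef
  have hsm : ∀ i, ContDiffOn ℝ (⊤ : ℕ∞) (pd (eS i) U) Ω := fun i => pd_smooth hΩ hU _
  have hcg : ContinuousOn g K :=
    continuousOn_finsetSum _ fun i _ => ((hsm i).continuousOn.mono hK).pow 2
  have hcη : Continuous η := by
    simp only [hη]; fun_prop
  have hcQ : ContinuousOn (fun p => η p * g p / U p) K :=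
    (hcη.continuousOn.mul hcg).div (hU.continuousOn.mono hK) fun p hp => (hpos p (hK hp)).1.ne'
  have hxb : (x, b) ∈ K := ⟨hx, right_mem_Icc.2 hab.le⟩
  obtain ⟨p, hpK, hpmax⟩ := ((isCompact_closedBall x₀ ρ).prod (isCompact_Icc (a := a) (b := b))).exists_isMaxOn
    ⟨_, hxb⟩ hcQ
  have hpΩ := hK hpK
  have hUp := hpos p hpΩ
  set M := η p * g p / U p with hMdef
  have hle : ∀ q ∈ K, η q * g q ≤ M * U q := by
    intro q hq
    have h1 : η q * g q / U q ≤ M := hpmax hq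
    rwa [div_le_iff₀ (hpos q (hK hq)).1] at h1
  have heq : η p * g p = M * U p := by rw [hMdef, div_mul_cancel₀ _ hUp.1.ne']
  suffices hM : M ≤ D * (4 * ρ ^ 4 + (16 * n + 160) * ρ ^ 2 * (b - a)) by
    have h1 := hle _ hxb
    have h2 := mul_le_mul_of_nonneg_right hM (hpos _ (hK hxb)).1.le
    simp only [hη, hg] at h1
    linarith
  have hba : 0 < b - a := sub_pos.2 hab
  rcases le_or_gt M 0 with hM0 | hM0
  · exact hM0.trans (by positivity)
  obtain ⟨y, t⟩ := p
  obtain ⟨hy, ht⟩ := hpK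
  simp only [mem_closedBall, dist_eq_norm] at hy
  simp only [mem_Icc] at ht
  have hηpos : 0 < η (y, t) := by
    have h0 : 0 < η (y, t) * g (y, t) := heq ▸ mul_pos hM0 hUp.1
    have hg0 : 0 ≤ g (y, t) := by simp only [hg]; positivity
    exact pos_of_mul_pos_left h0 hg0
  have hσ : 0 < t - a := by
    rcases ht.1.eq_or_lt with h | h
    · simp [hη, ← h] at hηpos
    · linarith
  have hyρ : ‖y - x₀‖ < ρ := by
    rcases hy.eq_or_lt with h | h
    · simp [hη, h] at hηpos
    · exact h
  have hr : ‖y - x₀‖ ^ 2 = ∑ i, (y - x₀) i ^ 2 := by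
    rw [EuclideanSpace.norm_sq_eq]; simp
  -- nearby points
  have hline : ∀ e : EuclideanSpace ℝ (Fin n) × ℝ, Tendsto (fun s : ℝ => (y, t) + s • e) (𝓝 0) (𝓝 (y, t)) := by
    intro e
    have : Continuous (fun s : ℝ => (y, t) + s • e) := by fun_prop
    simpa using this.tendsto 0
  have hΩe : ∀ e : EuclideanSpace ℝ (Fin n) × ℝ, ∀ᶠ s in 𝓝 (0:ℝ), (y, t) + s • e ∈ Ω :=
    fun e => (hline e).eventually (hΩ.mem_nhds hpΩ)
  have hBe : ∀ e : EuclideanSpace ℝ (Fin n) × ℝ, ∀ᶠ s in 𝓝 (0:ℝ),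
      ‖((y, t) + s • e).1 - x₀‖ < ρ ∧ a < ((y, t) + s • e).2 := by
    intro e
    refine (hline e).eventually (IsOpen.mem_nhds (s := {q : EuclideanSpace ℝ (Fin n) × ℝ | ‖q.1 - x₀‖ < ρ ∧ a < q.2}) ?_ ⟨hyρ, by simpa using hσ⟩)
    have o1 : IsOpen {q : EuclideanSpace ℝ (Fin n) × ℝ | ‖q.1 - x₀‖ < ρ} :=
      isOpen_lt (by fun_prop) (by fun_prop)
    have o2 : IsOpen {q : EuclideanSpace ℝ (Fin n) × ℝ | a < q.2} :=
      isOpen_lt (by fun_prop) (by fun_prop)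
    exact o1.inter o2
  have hηline : ∀ i (s : ℝ), η ((y, t) + s • eS i) =
      (t - a) * (ρ ^ 2 - (‖y - x₀‖ ^ 2 + 2 * s * (y - x₀) i + s ^ 2)) ^ 2 := by
    intro i s
    have : ‖y + s • EuclideanSpace.single i (1:ℝ) - x₀‖ ^ 2
        = ‖y - x₀‖ ^ 2 + 2 * s * (y - x₀) i + s ^ 2 := by
      rw [show y + s • EuclideanSpace.single i (1:ℝ) - x₀ = (y - x₀) + s • EuclideanSpace.single i (1:ℝ) by abel,
        norm_add_sq_real, inner_smul_right, norm_smul, EuclideanSpace.inner_single_right]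
      simp [mul_assoc]
    simp [hη, eS, this]
  have hspace : ∀ i, _ := fun i => line_test
    (fun s => (t - a) * (ρ ^ 2 - (‖y - x₀‖ ^ 2 + 2 * s * (y - x₀) i + s ^ 2)) ^ 2)
    (fun s => -4 * (t - a) * (ρ ^ 2 - (‖y - x₀‖ ^ 2 + 2 * s * (y - x₀) i + s ^ 2)) * ((y - x₀) i + s))
    ((t - a) * (-4 * (ρ ^ 2 - ‖y - x₀‖ ^ 2) + 8 * (y - x₀) i ^ 2))
    (fun j s => pd (eS j) U ((y, t) + s • eS i))
    (fun j s => pd (eS i) (pd (eS j) U) ((y, t) + s • eS i))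
    (fun j => pd (eS i) (pd (eS i) (pd (eS j) U)) (y, t))
    (fun s => U ((y, t) + s • eS i))
    (fun s => pd (eS i) U ((y, t) + s • eS i))
    (pd (eS i) (pd (eS i) U) (y, t)) M
    (by
      intro s
      have h1 : HasDerivAt (fun s : ℝ => ρ ^ 2 - (‖y - x₀‖ ^ 2 + 2 * s * (y - x₀) i + s ^ 2))
          (-(2 * (y - x₀) i + 2 * s)) s := by
        have := ((((hasDerivAt_id s).const_mul 2).mul_const ((y - x₀) i)).const_add (‖y - x₀‖ ^ 2)).add
          ((hasDerivAt_id s).fun_pow 2) |>.const_sub (ρ ^ 2)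
        exact this.congr_deriv (by simp)
      exact ((h1.fun_pow 2).const_mul (t - a)).congr_deriv (by norm_num; ring))
    (by
      have h1 : HasDerivAt (fun s : ℝ => ρ ^ 2 - (‖y - x₀‖ ^ 2 + 2 * s * (y - x₀) i + s ^ 2))
          (-(2 * (y - x₀) i + 2 * 0)) 0 := by
        have := ((((hasDerivAt_id (0:ℝ)).const_mul 2).mul_const ((y - x₀) i)).const_add (‖y - x₀‖ ^ 2)).add
          ((hasDerivAt_id (0:ℝ)).fun_pow 2) |>.const_sub (ρ ^ 2)
        exact this.congr_deriv (by simp)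
      exact ((h1.const_mul (-4 * (t - a))).mul ((hasDerivAt_id (0:ℝ)).const_add ((y - x₀) i))).congr_deriv
        (by simp; ring))
    (by
      intro j
      filter_upwards [hΩe (eS i)] with s hs using pd_line hΩ (hsm j) _ _ s hs)
    (by
      intro j
      simpa using pd_line hΩ (pd_smooth hΩ (hsm j) (eS i)) (eS i) (y, t) 0 (by simpa using hpΩ))
    (by
      filter_upwards [hΩe (eS i)] with s hs using pd_line hΩ hU _ _ s hs)
    (by
      simpa using pd_line hΩ (hsm i) (eS i) (y, t) 0 (by simpa using hpΩ))
    (by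
      filter_upwards [hBe (eS i)] with s hs
      have h1 := hle ((y, t) + s • eS i) ⟨by simpa [dist_eq_norm] using hs.1.le, hs.2.le, by simpa [eS] using ht.2⟩
      have h2 := hηline i 0
      rw [← hηline i s, ← hηline i 0]
      simp only [zero_smul, add_zero]
      have h3 : g (y, t) = ∑ j, pd (eS j) U (y, t) ^ 2 := rfl
      have h4 : g ((y, t) + s • eS i) = ∑ j, pd (eS j) U ((y, t) + s • eS i) ^ 2 := rfl
      rw [← h3, ← h4]
      linarith)
  have htime : 0 ≤ (ρ ^ 2 - ‖y - x₀‖ ^ 2) ^ 2 * (∑ j, pd (eS j) U (y, t) ^ 2)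
      + 2 * ((t - a) * (ρ ^ 2 - ‖y - x₀‖ ^ 2) ^ 2) *
        (∑ j, pd (0, 1) (pd (eS j) U) (y, t) * pd (eS j) U (y, t)) - M * pd (0, 1) U (y, t) := by
    have hd : HasDerivAt (fun s : ℝ => (t + s - a) * (ρ ^ 2 - ‖y - x₀‖ ^ 2) ^ 2 *
        (∑ j, pd (eS j) U ((y, t) + s • (0, 1)) ^ 2) - M * U ((y, t) + s • (0, 1)))
        ((ρ ^ 2 - ‖y - x₀‖ ^ 2) ^ 2 * (∑ j, pd (eS j) U (y, t) ^ 2)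
      + ((t - a) * (ρ ^ 2 - ‖y - x₀‖ ^ 2) ^ 2) *
        (∑ j, 2 * (pd (0, 1) (pd (eS j) U) (y, t) * pd (eS j) U (y, t))) - M * pd (0, 1) U (y, t)) 0 := by
      have l0 := pd_line hΩ hU (0, 1) (y, t) 0 (by simpa using hpΩ)
      have l1 := fun j => (pd_line hΩ (hsm j) (0, 1) (y, t) 0 (by simpa using hpΩ)).fun_pow 2
      have l2 : HasDerivAt (fun s : ℝ => (t + s - a) * (ρ ^ 2 - ‖y - x₀‖ ^ 2) ^ 2)
          ((ρ ^ 2 - ‖y - x₀‖ ^ 2) ^ 2) 0 :=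
        ((((hasDerivAt_id (0:ℝ)).const_add t).sub_const a).mul_const _).congr_deriv (by ring)
      refine ((l2.mul (HasDerivAt.fun_sum fun j _ => l1 j)).sub (l0.const_mul M)).congr_deriv ?_
      simp only [zero_smul, add_zero]
      congr 3
      refine Finset.sum_congr rfl fun j _ => ?_
      norm_num; ring
    have := left_test _ _ hd (by
      filter_upwards [self_mem_nhdsWithin, nhdsWithin_le_nhds (hBe (0, 1))] with s hs0 hs
      simp only [mem_Iio] at hs0
      have hmem : (y, t) + s • ((0, 1) : EuclideanSpace ℝ (Fin n) × ℝ) ∈ K :=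
        ⟨by simpa [dist_eq_norm] using hs.1.le, hs.2.le, by simp; linarith [ht.2]⟩
      have h1 := hle _ hmem
      have h4 : η ((y, t) + s • ((0, 1) : EuclideanSpace ℝ (Fin n) × ℝ)) = (t + s - a) * (ρ ^ 2 - ‖y - x₀‖ ^ 2) ^ 2 := by
        simp [hη]
      have h5 : η (y, t) = (t - a) * (ρ ^ 2 - ‖y - x₀‖ ^ 2) ^ 2 := rfl
      rw [h4] at h1
      rw [h5] at heq
      simp only [zero_smul, add_zero]
      simp only [hg] at h1 heq
      linarith)
    simp only [← Finset.mul_sum] at this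
    linarith
  have hfin := alg_core (fun i j => pd (eS i) (pd (eS j) U) (y, t))
    (fun i j => pd (eS i) (pd (eS i) (pd (eS j) U)) (y, t)) (fun i => (y - x₀) i)
    (fun j => pd (eS j) U (y, t)) (fun j => pd (0, 1) (pd (eS j) U) (y, t)) M (U (y, t))
    (pd (0, 1) U (y, t)) ρ (t - a) (‖y - x₀‖ ^ 2) hM0 hUp.1 hσ hr
    (by gcongr) heq
    (fun i => by
      have := (hspace i).1
      simpa using this)
    (fun i => by
      have := (hspace i).2
      simpa using this) htime (heat _ hpΩ)
    (by
      intro j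
      have c1 : pd (0, 1) (pd (eS j) U) (y, t) = pd (eS j) (pd (0, 1) U) (y, t) := pd_comm hΩ hU _ _ hpΩ
      rw [c1, pd_congr hΩ heat (eS j) hpΩ,
        pd_sum _ _ _ fun i => pd_diff hΩ (pd_smooth hΩ (hsm i) (eS i)) hpΩ]
      refine Finset.sum_congr rfl fun i _ => ?_
      rw [pd_comm hΩ (hsm i) _ _ hpΩ]
      exact pd_congr hΩ (fun q hq => pd_comm hΩ hU _ _ hq) _ hpΩ)
  refine hfin.trans ?_
  have hta : t - a ≤ b - a := by linarith [ht.2]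
  gcongr
  exact hUp.2

lemma slice_fderiv {n : ℕ} (f : EuclideanSpace ℝ (Fin n) × ℝ → ℝ) (x v : EuclideanSpace ℝ (Fin n)) (t : ℝ)
    (h : DifferentiableAt ℝ f (x, t)) : fderiv ℝ (fun y => f (y, t)) x v = pd (v, 0) f (x, t) := by
  have h1 : HasFDerivAt (fun y : EuclideanSpace ℝ (Fin n) => (y, t))
      (ContinuousLinearMap.inl ℝ (EuclideanSpace ℝ (Fin n)) ℝ) x := hasFDerivAt_prodMk_left x t
  have h2 := HasFDerivAt.comp (g := f) x h.hasFDerivAt h1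
  have h3 : fderiv ℝ (fun y => f (y, t)) x = _ := h2.fderiv
  rw [h3]
  simp [pd]

lemma slice_deriv {n : ℕ} (f : EuclideanSpace ℝ (Fin n) × ℝ → ℝ) (x : EuclideanSpace ℝ (Fin n)) (t : ℝ)
    (h : DifferentiableAt ℝ f (x, t)) : deriv (fun s => f (x, s)) t = pd (0, 1) f (x, t) := by
  have h1 : HasDerivAt (fun s : ℝ => (x, s)) ((0 : EuclideanSpace ℝ (Fin n)), (1:ℝ)) t :=
    (hasDerivAt_const t x).prodMk (hasDerivAt_id t)
  exact (HasFDerivAt.comp_hasDerivAt (l := f) t h.hasFDerivAt h1).deriv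

lemma slice_within {n : ℕ} (f : EuclideanSpace ℝ (Fin n) × ℝ → ℝ) (x₀ x v : EuclideanSpace ℝ (Fin n))
    (R t : ℝ) (I : Set ℝ) (ht : t ∈ I) (hx : x ∈ ball x₀ R)
    (h : DifferentiableWithinAt ℝ f (ball x₀ R ×ˢ I) (x, t)) :
    fderiv ℝ (fun y => f (y, t)) x v = fderivWithin ℝ f (ball x₀ R ×ˢ I) (x, t) (v, 0) := by
  have h1 : HasFDerivWithinAt (fun y : EuclideanSpace ℝ (Fin n) => (y, t))
      (ContinuousLinearMap.inl ℝ (EuclideanSpace ℝ (Fin n)) ℝ) (ball x₀ R) x :=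
    (hasFDerivAt_prodMk_left x t).hasFDerivWithinAt
  have hm : MapsTo (fun y : EuclideanSpace ℝ (Fin n) => (y, t)) (ball x₀ R) (ball x₀ R ×ˢ I) :=
    fun y hy => ⟨hy, ht⟩
  have h2 := HasFDerivWithinAt.comp (g := f) x h.hasFDerivWithinAt h1 hm
  have h3 : fderiv ℝ (fun y => f (y, t)) x = _ := (h2.hasFDerivAt (isOpen_ball.mem_nhds hx)).fderiv
  rw [h3]
  simp

lemma grad_norm_sq {n : ℕ} (f : EuclideanSpace ℝ (Fin n) → ℝ) (x : EuclideanSpace ℝ (Fin n)) :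
    ‖gradient f x‖ ^ 2 = ∑ i, (fderiv ℝ f x (EuclideanSpace.single i 1)) ^ 2 := by
  rw [EuclideanSpace.norm_sq_eq]
  refine Finset.sum_congr rfl fun i _ => ?_
  rw [← inner_gradient_left, EuclideanSpace.inner_single_right]
  simp

lemma const_arith (N R τ D g U r : ℝ) (hN : 0 ≤ N) (hR : 0 < R) (hτ : 0 < τ) (hD : 0 < D) (hU : 0 < U)
    (hg : 0 ≤ g) (hr0 : 0 ≤ r) (hr : r < R / 2)
    (h : (τ / 2) * ((3 * R / 4) ^ 2 - r ^ 2) ^ 2 * g ≤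
      U * (D * (4 * (3 * R / 4) ^ 4 + (16 * N + 160) * (3 * R / 4) ^ 2 * (τ / 2)))) :
    g ≤ U * (D * ((96 * N + 960) * (1 / R ^ 2 + 1 / τ))) := by
  have h1 : (5 * R ^ 2 / 16) ^ 2 ≤ ((3 * R / 4) ^ 2 - r ^ 2) ^ 2 := by
    have : r ^ 2 ≤ (R / 2) ^ 2 := by gcongr
    gcongr
    linarith
  have h2 : (τ / 2) * (5 * R ^ 2 / 16) ^ 2 * g ≤
      U * (D * (4 * (3 * R / 4) ^ 4 + (16 * N + 160) * (3 * R / 4) ^ 2 * (τ / 2))) :=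
    le_trans (by gcongr) h
  refine le_of_mul_le_mul_left (h2.trans ?_) (by positivity : 0 < (τ / 2) * (5 * R ^ 2 / 16) ^ 2)
  have h3 : (τ / 2) * (5 * R ^ 2 / 16) ^ 2 * (U * (D * ((96 * N + 960) * (1 / R ^ 2 + 1 / τ))))
      = U * (D * ((25 / 512) * (96 * N + 960) * (R ^ 2 * τ + R ^ 4))) := by
    field_simp
    ring
  rw [h3]
  gcongr
  have p1 : 0 ≤ R ^ 2 * τ := by positivity
  have p2 : 0 ≤ R ^ 4 := by positivity
  have p3 : 0 ≤ N * (R ^ 2 * τ) := by positivity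
  have p4 : 0 ≤ N * R ^ 4 := by positivity
  nlinarith

end helpers

/-- Elliptic gradient estimate for the heat equation on Euclidean space
(Euclidean case of estimate (3.12)). -/
theorem heat_gradient_estimate (n : ℕ) (hn : 1 ≤ n) :
    ∃ c : ℝ, 0 < c ∧
      ∀ (x₀ : EuclideanSpace ℝ (Fin n)) (R t₀ T D : ℝ)
        (u : EuclideanSpace ℝ (Fin n) → ℝ → ℝ),
        0 < R → 0 < T → 0 < D →
        ContDiffOn ℝ (⊤ : ℕ∞) (fun p : EuclideanSpace ℝ (Fin n) × ℝ => u p.1 p.2)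
          (ball x₀ R ×ˢ Icc (t₀ - T) t₀) →
        (∀ x ∈ ball x₀ R, ∀ t ∈ Icc (t₀ - T) t₀, 0 < u x t ∧ u x t ≤ D) →
        (∀ x ∈ ball x₀ R, ∀ t ∈ Icc (t₀ - T) t₀,
          deriv (fun s => u x s) t = eLap (fun y => u y t) x) →
        ∀ x ∈ ball x₀ (R / 2), ∀ t ∈ Ioc (t₀ - T) t₀,
          ‖gradient (fun y => u y t) x‖ / Real.sqrt (u x t) ≤
            c * Real.sqrt D * (1 / R + 1 / Real.sqrt (t - t₀ + T)) := by
  refine ⟨Real.sqrt (96 * n + 960), Real.sqrt_pos.2 (by positivity), ?_⟩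
  intro x₀ R t₀ T D u hR hT hD hu hpos heat x hx t ht
  set U : EuclideanSpace ℝ (Fin n) × ℝ → ℝ := fun p => u p.1 p.2 with hUdef
  set S := ball x₀ R ×ˢ Icc (t₀ - T) t₀ with hS
  set Ω := ball x₀ R ×ˢ Ioo (t₀ - T) t₀ with hΩdef
  have hΩ : IsOpen Ω := isOpen_ball.prod isOpen_Ioo
  have hΩS : Ω ⊆ S := prod_mono_right Ioo_subset_Icc_self
  have hUΩ : ContDiffOn ℝ (⊤ : ℕ∞) U Ω := hu.mono hΩS
  have hxR : x ∈ ball x₀ R := ball_subset_ball (by linarith) hx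
  have hheat : ∀ p ∈ Ω, pd (0, 1) U p = ∑ i, pd (eS i) (pd (eS i) U) p := by
    rintro ⟨y, s⟩ ⟨hy, hs⟩
    have hp : (y, s) ∈ Ω := ⟨hy, hs⟩
    rw [← slice_deriv U y s (pd_diff hΩ hUΩ hp)]
    refine (heat y hy s (Ioo_subset_Icc_self hs)).trans (Finset.sum_congr rfl fun i _ => ?_)
    have e1 : (fun z => fderiv ℝ (fun y => u y s) z (EuclideanSpace.single i 1))
        =ᶠ[nhds y] fun z => pd (eS i) U (z, s) := by
      filter_upwards [isOpen_ball.mem_nhds hy] with z hz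
      exact slice_fderiv U z _ s (pd_diff hΩ hUΩ ⟨hz, hs⟩)
    rw [e1.fderiv_eq]
    exact slice_fderiv _ y _ s (pd_diff hΩ (pd_smooth hΩ hUΩ (eS i)) hp)
  have hint : ∀ s ∈ Ioo (t₀ - T) t₀, ‖gradient (fun y => u y s) x‖ ^ 2 ≤
      u x s * (D * ((96 * n + 960) * (1 / R ^ 2 + 1 / (s - t₀ + T)))) := by
    intro s hs
    have hτ : 0 < s - t₀ + T := by linarith [hs.1]
    have hxd : ‖x - x₀‖ < R / 2 := by simpa [dist_eq_norm] using hx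
    refine const_arith n R (s - t₀ + T) D _ (u x s) ‖x - x₀‖ (by positivity) hR hτ hD
      (hpos x hxR s (Ioo_subset_Icc_self hs)).1 (by positivity) (norm_nonneg _) hxd ?_
    have key := interior_est x₀ (3 * R / 4) (s - (s - t₀ + T) / 2) s D (by positivity) hD (by linarith) Ω hΩ
      (prod_mono (closedBall_subset_ball (by linarith))
        (fun z hz => ⟨by linarith [hz.1], by linarith [hz.2, hs.2]⟩)) U hUΩ
      (fun p hp => hpos p.1 hp.1 p.2 (Ioo_subset_Icc_self hp.2)) hheat x
      (by rw [mem_closedBall, dist_eq_norm]; linarith)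
    rw [sub_sub_cancel] at key
    have e2 : ‖gradient (fun y => u y s) x‖ ^ 2 = ∑ i, pd (eS i) U (x, s) ^ 2 := by
      rw [grad_norm_sq]
      refine Finset.sum_congr rfl fun i _ => ?_
      congr 1
      exact slice_fderiv U x _ s (pd_diff hΩ hUΩ ⟨hxR, hs⟩)
    rw [e2]
    exact key
  have hall : ∀ s ∈ Ioc (t₀ - T) t₀, ‖gradient (fun y => u y s) x‖ ^ 2 ≤
      u x s * (D * ((96 * n + 960) * (1 / R ^ 2 + 1 / (s - t₀ + T)))) := by
    intro s hs
    rcases hs.2.eq_or_lt with rfl | hlt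
    · have hUD : UniqueDiffOn ℝ S :=
        isOpen_ball.uniqueDiffOn.prod (uniqueDiffOn_Icc (by linarith))
      have hc := hu.continuousOn_fderivWithin hUD (by exact_mod_cast le_top)
      have hm : MapsTo (fun r : ℝ => (x, r)) (Icc (s - T) s) S := fun r hr => ⟨hxR, hr⟩
      have hcx : ContinuousOn (fun r : ℝ => fderivWithin ℝ U S (x, r)) (Icc (s - T) s) :=
        hc.comp (by fun_prop) hm
      have hcg : ContinuousOn (fun r => ‖gradient (fun y => u y r) x‖ ^ 2) (Icc (s - T) s) := by
        have : ContinuousOn (fun r => ∑ i : Fin n,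
            (fderivWithin ℝ U S (x, r) (EuclideanSpace.single i 1, 0)) ^ 2) (Icc (s - T) s) :=
          continuousOn_finsetSum _ fun i _ => (hcx.clm_apply continuousOn_const).pow 2
        refine this.congr fun r hr => ?_
        simp only
        rw [grad_norm_sq]
        refine Finset.sum_congr rfl fun i _ => ?_
        congr 1
        exact slice_within U x₀ x _ R r _ hr hxR ((hu.differentiableOn (by simp)) _ ⟨hxR, hr⟩)
      have hcu : ContinuousOn (fun r => u x r) (Icc (s - T) s) :=
        hu.continuousOn.comp (f := fun r : ℝ => (x, r)) (by fun_prop) hm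
      have hcr : ContinuousOn (fun r => u x r * (D * ((96 * n + 960) * (1 / R ^ 2 + 1 / (r - s + T)))))
          (Ioc (s - T) s) := by
        refine (hcu.mono Ioc_subset_Icc_self).mul (continuousOn_const.mul (continuousOn_const.mul
          (continuousOn_const.add (continuousOn_const.div (by fun_prop) ?_))))
        intro r hr
        have := hr.1
        exact ne_of_gt (by linarith)
      have hsm : s ∈ closure (Ioo (s - T) s) := by
        rw [closure_Ioo (by linarith)]; exact ⟨by linarith, le_rfl⟩
      have hne : (nhdsWithin s (Ioo (s - T) s)).NeBot := mem_closure_iff_nhdsWithin_neBot.1 hsm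
      refine le_of_tendsto_of_tendsto
        ((hcg s ⟨by linarith, le_rfl⟩).mono Ioo_subset_Icc_self)
        ((hcr s hs).mono Ioo_subset_Ioc_self) ?_
      filter_upwards [self_mem_nhdsWithin] with r hr using hint r hr
    · exact hint s ⟨hs.1, hlt⟩
  have hfin := hall t ht
  have hup := (hpos x hxR t (Ioc_subset_Icc_self ht)).1
  have hτ : 0 < t - t₀ + T := by linarith [ht.1]
  rw [div_le_iff₀ (Real.sqrt_pos.2 hup)]
  refine abs_le_of_sq_le_sq' (hfin.trans ?_) (by positivity) |>.2
  rw [mul_pow, mul_pow, mul_pow, Real.sq_sqrt hup.le, Real.sq_sqrt hD.le, Real.sq_sqrt (by positivity)]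
  have hq : 1 / R ^ 2 + 1 / (t - t₀ + T) ≤ (1 / R + 1 / Real.sqrt (t - t₀ + T)) ^ 2 := by
    have e4 : (1 / Real.sqrt (t - t₀ + T)) ^ 2 = 1 / (t - t₀ + T) := by
      rw [div_pow, Real.sq_sqrt hτ.le, one_pow]
    have e5 : (1 / R) ^ 2 = 1 / R ^ 2 := by rw [div_pow, one_pow]
    have e6 : 0 ≤ (1 / R) * (1 / Real.sqrt (t - t₀ + T)) := by positivity
    rw [← e4, ← e5]
    nlinarith
  calc u x t * (D * ((96 * n + 960) * (1 / R ^ 2 + 1 / (t - t₀ + T))))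
      ≤ u x t * (D * ((96 * n + 960) * (1 / R + 1 / Real.sqrt (t - t₀ + T)) ^ 2)) := by gcongr
    _ = _ := by ring
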